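/- arXiv:2604.19462 — 9 statements merged into one kernel-verified Lean document; each statement's English description precedes it below -/
import Mathlib

section
/- Let 𝒳 ⊆ ℝ^{d_x} and 𝒴 ⊆ ℝ^{d_y} be nonempty convex compact sets, let 𝒵 = 𝒳 × 𝒴 have diameter D_𝒵 = sup_{z,z'∈𝒵} ‖z − z'‖, and let f : ℝ^{d_x} × ℝ^{d_y} → ℝ be differentiable and convex-concave on 𝒳 × 𝒴. Then for every z = (x,y) ∈ 𝒵 and every vector c in the normal cone N_𝒵(z), the duality gap satisfies Gap_f(x,y) ≤ D_𝒵 · ‖F(z) + c‖, where F(x,y) = (∇_x f(x,y), −∇_y f(x,y)). -/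
open scoped InnerProductSpace

noncomputable section

/-- The Euclidean space `ℝ^n`. -/
abbrev Euc (n : ℕ) := EuclideanSpace ℝ (Fin n)

/-- `ℝ^{d_x} × ℝ^{d_y}` with the Euclidean (`L²`) norm. -/
abbrev EucProd (dx dy : ℕ) := WithLp 2 (Euc dx × Euc dy)

/-- Pairing of `x` and `y` into the `L²` product. -/
def pmk {dx dy : ℕ} (x : Euc dx) (y : Euc dy) : EucProd dx dy :=
  (WithLp.equiv 2 (Euc dx × Euc dy)).symm (x, y)

/-- First-order characterization of convexity: on a convex set, a convex function lies above its
linearization at any point of the set where it is differentiable. -/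
theorem ConvexOn.inner_gradient_sub_le {E : Type*} [NormedAddCommGroup E] [InnerProductSpace ℝ E]
    [CompleteSpace E] {s : Set E} {g : E → ℝ} (hg : ConvexOn ℝ s g) {a b : E} (ha : a ∈ s)
    (hb : b ∈ s) (hd : DifferentiableAt ℝ g a) : ⟪gradient g a, b - a⟫_ℝ ≤ g b - g a := by
  have hconv : ConvexOn ℝ (AffineMap.lineMap a b ⁻¹' s) (g ∘ AffineMap.lineMap (k := ℝ) a b) :=
    hg.comp_affineMap _
  have hderiv : HasDerivAt (g ∘ AffineMap.lineMap (k := ℝ) a b) ⟪gradient g a, b - a⟫_ℝ 0 := by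
    have h : HasFDerivAt g (InnerProductSpace.toDual ℝ E (gradient g a))
        (AffineMap.lineMap a b (0 : ℝ)) := by
      simpa using hd.hasGradientAt.hasFDerivAt
    simpa using h.comp_hasDerivAt (0 : ℝ) AffineMap.hasDerivAt_lineMap
  have h := hconv.le_slope_of_hasDerivAt (x := 0) (y := 1) (by simpa using ha) (by simpa using hb)
    one_pos hderiv
  simpa [slope_def_field] using h

/-- The reversed first-order inequality for concave functions. -/
theorem ConcaveOn.sub_le_inner_gradient {E : Type*} [NormedAddCommGroup E] [InnerProductSpace ℝ E]
    [CompleteSpace E] {s : Set E} {g : E → ℝ} (hg : ConcaveOn ℝ s g) {a b : E} (ha : a ∈ s)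
    (hb : b ∈ s) (hd : DifferentiableAt ℝ g a) : g b - g a ≤ ⟪gradient g a, b - a⟫_ℝ := by
  have h := hg.neg.inner_gradient_sub_le ha hb hd.neg
  have hgrad : gradient (-g) a = -gradient g a := by
    simp [gradient, fderiv_neg]
  rw [hgrad, inner_neg_left] at h
  simp only [Pi.neg_apply] at h
  linarith

/-- Lemma 1 of the paper: the duality gap is bounded by the
diameter of `𝒵 = 𝒳 × 𝒴` times the tangent residual: for every `z = (x,y) ∈ 𝒵`
and every `c` in the normal cone `N_𝒵(z)`,
`Gap_f(x,y) ≤ D_𝒵 ‖F(z) + c‖`, where `F = (∇_x f, −∇_y f)`. -/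
theorem stmt0 (dx dy : ℕ)
    (X : Set (Euc dx)) (Y : Set (Euc dy))
    (hXne : X.Nonempty) (hYne : Y.Nonempty)
    (hXconv : Convex ℝ X) (hYconv : Convex ℝ Y)
    (hXcp : IsCompact X) (hYcp : IsCompact Y)
    (f : Euc dx → Euc dy → ℝ)
    (hdx : ∀ y, Differentiable ℝ (fun x => f x y))
    (hdy : ∀ x, Differentiable ℝ (fun y => f x y))
    (hcvx : ∀ y ∈ Y, ConvexOn ℝ X (fun x => f x y))
    (hccv : ∀ x ∈ X, ConcaveOn ℝ Y (fun y => f x y))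
    (Z : Set (EucProd dx dy))
    (hZ : Z = {z | (WithLp.equiv 2 (Euc dx × Euc dy) z).1 ∈ X ∧
      (WithLp.equiv 2 (Euc dx × Euc dy) z).2 ∈ Y})
    (x : Euc dx) (hx : x ∈ X) (y : Euc dy) (hy : y ∈ Y)
    (c : EucProd dx dy)
    (hc : ∀ z' ∈ Z, ⟪c, z' - pmk x y⟫_ℝ ≤ 0) :
    sSup ((fun y' => f x y') '' Y) - sInf ((fun x' => f x' y) '' X)
      ≤ Metric.diam Z *
        ‖pmk (gradient (fun x' => f x' y) x) (-gradient (fun y' => f x y') y) + c‖ := by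
  obtain ⟨y', hy', hmax⟩ := hYcp.exists_sSup_image_eq hYne (hdy x).continuous.continuousOn
  obtain ⟨x', hx', hmin⟩ := hXcp.exists_sInf_image_eq hXne (hdx y).continuous.continuousOn
  have hZcp : IsCompact Z := by
    have h : Z = (WithLp.homeomorphProd 2 (Euc dx) (Euc dy)) ⁻¹' (X ×ˢ Y) := by
      rw [hZ]
      rfl
    rw [h]
    exact (Homeomorph.isCompact_preimage _).2 (hXcp.prod hYcp)
  have hz : pmk x y ∈ Z := by
    rw [hZ]
    exact ⟨hx, hy⟩
  have hz' : pmk x' y' ∈ Z := by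
    rw [hZ]
    exact ⟨hx', hy'⟩
  have hfx := (hcvx y hy).inner_gradient_sub_le hx hx' (hdx y x)
  have hfy := (hccv x hx).sub_le_inner_gradient hy hy' (hdy x y)
  have hnormal := hc _ hz'
  set F := pmk (gradient (fun x' => f x' y) x) (-gradient (fun y' => f x y') y) with hF
  have hinner : ⟪F, pmk x' y' - pmk x y⟫_ℝ = ⟪gradient (fun x' => f x' y) x, x' - x⟫_ℝ
      - ⟪gradient (fun y' => f x y') y, y' - y⟫_ℝ := by
    simp [hF, pmk, WithLp.prod_inner_apply, sub_eq_add_neg]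
  have hcs : ⟪F + c, pmk x y - pmk x' y'⟫_ℝ ≤ Metric.diam Z * ‖F + c‖ := by
    refine (real_inner_le_norm _ _).trans ?_
    rw [mul_comm, ← dist_eq_norm]
    gcongr
    exact Metric.dist_le_diam_of_mem hZcp.isBounded hz hz'
  rw [← neg_sub, inner_neg_right, inner_add_left] at hcs
  rw [hmax, hmin]
  linarith
end
end

section
/- Let 𝒵 ⊆ ℝ^d be a nonempty closed convex set and let F : ℝ^d → ℝ^d be monotone and L-Lipschitz continuous. Suppose z* ∈ 𝒵 satisfies −F(z*) ∈ N_𝒵(z*). For η > 0 and z̄ ∈ ℝ^d, let z = Proj_𝒵(z̄ − η F(z̄)) be the metric projection. Then inf_{c ∈ N_𝒵(z)} ‖F(z) + c‖ ≤ ‖(z̄ − z)/η + F(z) − F(z̄)‖ ≤ (1/η + L)(2 + ηL)‖z̄ − z*‖. In particular, taking η = 1/L yields inf_{c ∈ N_𝒵(z)} ‖F(z) + c‖ ≤ 6L‖z̄ − z*‖. -/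
open scoped InnerProductSpace

noncomputable section

/-- The variational inequality characterizing a nearest point of a convex set. -/
theorem inner_sub_nonpos_of_forall_norm_le {E : Type*} [NormedAddCommGroup E]
    [InnerProductSpace ℝ E] {K : Set E} (hK : Convex ℝ K) {w z : E} (hz : z ∈ K)
    (h : ∀ u ∈ K, ‖z - w‖ ≤ ‖u - w‖) : ∀ u ∈ K, ⟪w - z, u - z⟫_ℝ ≤ 0 := by
  refine (norm_eq_iInf_iff_real_inner_le_zero hK hz).1 (le_antisymm ?_ ?_)
  · have : Nonempty K := ⟨⟨z, hz⟩⟩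
    refine le_ciInf fun u => ?_
    rw [norm_sub_rev w z, norm_sub_rev w u]
    exact h u u.2
  · refine ciInf_le (f := fun u : K => ‖w - u‖) ⟨0, ?_⟩ ⟨z, hz⟩
    rintro _ ⟨u, rfl⟩
    exact norm_nonneg _

/-- If `w - z` is normal at `z` and `w' - z'` is normal at `z'`, then `z` and `z'` are no farther
apart than `w` and `w'`. -/
theorem norm_sub_le_of_inner_sub_nonpos {E : Type*} [NormedAddCommGroup E]
    [InnerProductSpace ℝ E] {w z w' z' : E} (h : ⟪w - z, z' - z⟫_ℝ ≤ 0)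
    (h' : ⟪w' - z', z - z'⟫_ℝ ≤ 0) : ‖z - z'‖ ≤ ‖w - w'‖ := by
  have key : ‖z - z'‖ * ‖z - z'‖ ≤ ‖w - w'‖ * ‖z - z'‖ := by
    refine le_trans ?_ (real_inner_le_norm (w - w') (z - z'))
    have e : ⟪w - w', z - z'⟫_ℝ =
        ⟪z - z', z - z'⟫_ℝ - ⟪w - z, z' - z⟫_ℝ - ⟪w' - z', z - z'⟫_ℝ := by
      simp only [inner_sub_left, inner_sub_right]
      ring
    rw [← real_inner_self_eq_norm_mul_norm, e]
    linarith
  rcases (norm_nonneg (z - z')).eq_or_lt with h0 | h0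
  · rw [← h0]
    exact norm_nonneg _
  · exact le_of_mul_le_mul_right key h0

/-- one projected gradient step makes the tangent residual small.
`Z ⊆ ℝ^d` is nonempty closed convex, `F` is monotone and `L`-Lipschitz,
`z*` satisfies `−F(z*) ∈ N_Z(z*)`, and `z` is the metric projection of
`z̄ − η F(z̄)` onto `Z` (characterized as the point of `Z` minimizing the
distance).  The infimum of `‖F(z) + c‖` over the normal cone `N_Z(z)` is
bounded in terms of `‖z̄ − z*‖`; moreover if `η = 1/L` the bound is `6L‖z̄ − z*‖`. -/
theorem stmt1 (d : ℕ) (Z : Set (EuclideanSpace ℝ (Fin d)))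
    (hZne : Z.Nonempty) (hZcl : IsClosed Z) (hZconv : Convex ℝ Z)
    (F : EuclideanSpace ℝ (Fin d) → EuclideanSpace ℝ (Fin d)) (L : ℝ) (hL : 0 < L)
    (hmono : ∀ z z', ⟪F z - F z', z - z'⟫_ℝ ≥ 0)
    (hlip : ∀ z z', ‖F z - F z'‖ ≤ L * ‖z - z'‖)
    (zstar : EuclideanSpace ℝ (Fin d)) (hzsZ : zstar ∈ Z)
    (hzs : ∀ z' ∈ Z, ⟪-F zstar, z' - zstar⟫_ℝ ≤ 0)
    (η : ℝ) (hη : 0 < η) (zbar : EuclideanSpace ℝ (Fin d))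
    (z : EuclideanSpace ℝ (Fin d)) (hzZ : z ∈ Z)
    (hproj : ∀ u ∈ Z, ‖z - (zbar - η • F zbar)‖ ≤ ‖u - (zbar - η • F zbar)‖) :
    sInf ((fun c => ‖F z + c‖) '' {c | ∀ z' ∈ Z, ⟪c, z' - z⟫_ℝ ≤ 0})
        ≤ ‖(1 / η) • (zbar - z) + F z - F zbar‖ ∧
      ‖(1 / η) • (zbar - z) + F z - F zbar‖ ≤ (1 / η + L) * (2 + η * L) * ‖zbar - zstar‖ ∧
      (η = 1 / L →
        sInf ((fun c => ‖F z + c‖) '' {c | ∀ z' ∈ Z, ⟪c, z' - z⟫_ℝ ≤ 0})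
          ≤ 6 * L * ‖zbar - zstar‖) := by
  have hvi := inner_sub_nonpos_of_forall_norm_le hZconv hzZ hproj
  have hinf : sInf ((fun c => ‖F z + c‖) '' {c | ∀ z' ∈ Z, ⟪c, z' - z⟫_ℝ ≤ 0})
      ≤ ‖(1 / η) • (zbar - z) + F z - F zbar‖ := by
    refine csInf_le ⟨0, ?_⟩ ⟨(1 / η) • (zbar - η • F zbar - z), fun u hu => ?_, ?_⟩
    · rintro _ ⟨c, -, rfl⟩
      exact norm_nonneg _
    · rw [real_inner_smul_left]
      exact mul_nonpos_of_nonneg_of_nonpos (by positivity) (hvi u hu)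
    · have e : (1 / η) • (zbar - η • F zbar - z) = (1 / η) • (zbar - z) - F zbar := by
        rw [sub_right_comm, smul_sub, smul_smul, one_div_mul_cancel hη.ne', one_smul]
      simp only [e]
      congr 1
      abel
  have hstar : ⟪(zstar - η • F zstar) - zstar, z - zstar⟫_ℝ ≤ 0 := by
    rw [sub_sub_cancel_left, ← smul_neg, real_inner_smul_left]
    exact mul_nonpos_of_nonneg_of_nonpos hη.le (hzs z hzZ)
  have hstep : ‖z - zstar‖ ≤ (1 + η * L) * ‖zbar - zstar‖ :=
    calc ‖z - zstar‖ ≤ ‖(zbar - η • F zbar) - (zstar - η • F zstar)‖ :=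
          norm_sub_le_of_inner_sub_nonpos (hvi zstar hzsZ) hstar
      _ = ‖(zbar - zstar) - η • (F zbar - F zstar)‖ := by
          rw [smul_sub]
          congr 1
          abel
      _ ≤ ‖zbar - zstar‖ + η * ‖F zbar - F zstar‖ := by
          refine (norm_sub_le _ _).trans_eq ?_
          rw [norm_smul, Real.norm_of_nonneg hη.le]
      _ ≤ ‖zbar - zstar‖ + η * (L * ‖zbar - zstar‖) := by
          gcongr
          exact hlip _ _
      _ = (1 + η * L) * ‖zbar - zstar‖ := by ring
  have hdist : ‖zbar - z‖ ≤ (2 + η * L) * ‖zbar - zstar‖ := by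
    have := norm_sub_le_norm_sub_add_norm_sub zbar zstar z
    rw [norm_sub_rev zstar z] at this
    linarith
  have hbound : ‖(1 / η) • (zbar - z) + F z - F zbar‖
      ≤ (1 / η + L) * (2 + η * L) * ‖zbar - zstar‖ :=
    calc ‖(1 / η) • (zbar - z) + F z - F zbar‖
        ≤ ‖(1 / η) • (zbar - z)‖ + ‖F z - F zbar‖ := by
          rw [add_sub_assoc]
          exact norm_add_le _ _
      _ ≤ 1 / η * ‖zbar - z‖ + L * ‖zbar - z‖ := by
          rw [norm_smul, Real.norm_of_nonneg (by positivity), norm_sub_rev zbar z]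
          gcongr
          exact hlip _ _
      _ = (1 / η + L) * ‖zbar - z‖ := by ring
      _ ≤ (1 / η + L) * ((2 + η * L) * ‖zbar - zstar‖) := by gcongr
      _ = (1 / η + L) * (2 + η * L) * ‖zbar - zstar‖ := by ring
  refine ⟨hinf, hbound, fun h => (hinf.trans hbound).trans_eq ?_⟩
  rw [h, one_div_one_div, one_div_mul_cancel hL.ne']
  ring
end
end

section
/- Let 𝒳 ⊆ ℝ^{d_x}, 𝒴 ⊆ ℝ^{d_y} be nonempty convex compact sets with diameters D_𝒳, D_𝒴 > 0, let 𝒵 = 𝒳 × 𝒴, let p ≥ 1 be an integer, ε > 0, x₀ ∈ 𝒳, y₀ ∈ 𝒴, and let f be differentiable on a neighborhood of 𝒵. Set μ_x = ε/(4 D_𝒳^p), μ_y = ε/(4 D_𝒴^p), and f_ε(x,y) = f(x,y) + (μ_x/(p+1))‖x − x₀‖^{p+1} − (μ_y/(p+1))‖y − y₀‖^{p+1}, with saddle operators F(x,y) = (∇_x f, −∇_y f) and F_ε(x,y) = (∇_x f_ε, −∇_y f_ε). If ẑ = (x̂, ŷ) ∈ 𝒵 satisfies inf_{c ∈ N_𝒵(ẑ)}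 ‖F_ε(ẑ) + c‖ ≤ ε/2, then inf_{c ∈ N_𝒵(ẑ)} ‖F(ẑ) + c‖ ≤ ε. -/
open scoped InnerProductSpace

noncomputable section

/-- The gradient of the regularizer `(μ/(p+1))‖x − x₀‖^(p+1)`. -/
lemma hasGradientAt_const_mul_norm_sub_pow {E : Type*} [NormedAddCommGroup E]
    [InnerProductSpace ℝ E] [CompleteSpace E] (p : ℕ) (hp : 1 ≤ p) (μ : ℝ) (x₀ x : E) :
    HasGradientAt (fun x' => (μ / ((p : ℝ) + 1)) * ‖x' - x₀‖ ^ (p + 1))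
      ((μ * ‖x - x₀‖ ^ (p - 1)) • (x - x₀)) x := by
  have hp' : (1 : ℝ) < ((p + 1 : ℕ) : ℝ) := by exact_mod_cast Nat.lt_succ_of_le hp
  have h := ((hasFDerivAt_norm_rpow (x - x₀) hp').comp x
    ((hasFDerivAt_id x).sub_const x₀)).const_mul (μ / ((p : ℝ) + 1))
  rw [hasGradientAt_iff_hasFDerivAt]
  have hexp : ((p + 1 : ℕ) : ℝ) - 2 = ((p - 1 : ℕ) : ℝ) := by
    push_cast [Nat.cast_sub hp]
    ring
  rw [hexp] at h
  simp only [Real.rpow_natCast, Function.comp_def, id] at h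
  refine h.congr_fderiv ?_
  ext v
  have hp0 : (p : ℝ) + 1 ≠ 0 := by positivity
  simp
  field_simp

/-- The regularizer with `μ = ε/(4 D^p)` has gradient of norm at most `ε/4` on a bounded set of
diameter `D`. -/
lemma norm_regularizer_gradient_le {E : Type*} [NormedAddCommGroup E] [NormedSpace ℝ E]
    (p : ℕ) (hp : 1 ≤ p) {ε : ℝ} (hε : 0 < ε) {X : Set E} (hX : Bornology.IsBounded X)
    (hD : 0 < Metric.diam X) {x₀ x : E} (hx₀ : x₀ ∈ X) (hx : x ∈ X) :
    ‖(ε / (4 * Metric.diam X ^ p) * ‖x - x₀‖ ^ (p - 1)) • (x - x₀)‖ ≤ ε / 4 := by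
  have hd : ‖x - x₀‖ ≤ Metric.diam X := by
    rw [← dist_eq_norm]
    exact Metric.dist_le_diam_of_mem hX hx hx₀
  rw [norm_smul, Real.norm_of_nonneg (by positivity), mul_assoc, pow_sub_one_mul (by omega)]
  calc ε / (4 * Metric.diam X ^ p) * ‖x - x₀‖ ^ p
      ≤ ε / (4 * Metric.diam X ^ p) * Metric.diam X ^ p := by gcongr
    _ = ε / 4 := by field_simp

lemma norm_pmk_le {dx dy : ℕ} (x : Euc dx) (y : Euc dy) : ‖pmk x y‖ ≤ ‖x‖ + ‖y‖ := by
  rw [WithLp.prod_norm_eq_of_L2]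
  refine Real.sqrt_le_iff.mpr ⟨by positivity, ?_⟩
  change ‖x‖ ^ 2 + ‖y‖ ^ 2 ≤ _
  nlinarith [norm_nonneg x, norm_nonneg y]

lemma pmk_add {dx dy : ℕ} (x x' : Euc dx) (y y' : Euc dy) :
    pmk (x + x') (y + y') = pmk x y + pmk x' y' := rfl

/-- Perturbing a vector by `b` raises its infimal residual by at most `‖b‖`. -/
lemma sInf_norm_add_image_le {E : Type*} [SeminormedAddCommGroup E] {N : Set E}
    (hN : N.Nonempty) (a b : E) :
    sInf ((fun c => ‖a + c‖) '' N) ≤ sInf ((fun c => ‖a + b + c‖) '' N) + ‖b‖ := by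
  rw [← sub_le_iff_le_add]
  refine le_csInf (hN.image _) ?_
  rintro _ ⟨c, hc, rfl⟩
  have h1 : sInf ((fun c => ‖a + c‖) '' N) ≤ ‖a + c‖ :=
    csInf_le ⟨0, by rintro _ ⟨c, -, rfl⟩; exact norm_nonneg _⟩ ⟨c, hc, rfl⟩
  have h2 : ‖a + c‖ ≤ ‖a + b + c‖ + ‖b‖ := by
    have := norm_sub_le (a + b + c) b
    rwa [show a + b + c - b = a + c by abel] at this
  linarith

/-- with `μ_x = ε/(4 D_𝒳^p)`, `μ_y = ε/(4 D_𝒴^p)` and the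
regularized surrogate
`f_ε(x,y) = f(x,y) + (μ_x/(p+1))‖x − x₀‖^(p+1) − (μ_y/(p+1))‖y − y₀‖^(p+1)`,
any `(ε/2)`-solution `ẑ = (x̂, ŷ)` of `f_ε` (in the sense of tangent residual)
is an `ε`-solution of `f`. -/
theorem stmt5 (dx dy p : ℕ) (hp : 1 ≤ p) (ε : ℝ) (hε : 0 < ε)
    (X : Set (Euc dx)) (Y : Set (Euc dy))
    (hXne : X.Nonempty) (hYne : Y.Nonempty)
    (hXconv : Convex ℝ X) (hYconv : Convex ℝ Y)
    (hXcp : IsCompact X) (hYcp : IsCompact Y)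
    (hDX : 0 < Metric.diam X) (hDY : 0 < Metric.diam Y)
    (x₀ : Euc dx) (hx₀ : x₀ ∈ X) (y₀ : Euc dy) (hy₀ : y₀ ∈ Y)
    (f : Euc dx → Euc dy → ℝ)
    (hdx : ∀ y ∈ Y, ∀ x ∈ X, DifferentiableAt ℝ (fun x' => f x' y) x)
    (hdy : ∀ x ∈ X, ∀ y ∈ Y, DifferentiableAt ℝ (fun y' => f x y') y)
    (μx μy : ℝ)
    (hμx : μx = ε / (4 * Metric.diam X ^ p)) (hμy : μy = ε / (4 * Metric.diam Y ^ p))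
    (fε : Euc dx → Euc dy → ℝ)
    (hfε : fε = fun x y => f x y + (μx / ((p : ℝ) + 1)) * ‖x - x₀‖ ^ (p + 1)
      - (μy / ((p : ℝ) + 1)) * ‖y - y₀‖ ^ (p + 1))
    (Z : Set (EucProd dx dy))
    (hZ : Z = {z | (WithLp.equiv 2 (Euc dx × Euc dy) z).1 ∈ X ∧
      (WithLp.equiv 2 (Euc dx × Euc dy) z).2 ∈ Y})
    (xh : Euc dx) (hxh : xh ∈ X) (yh : Euc dy) (hyh : yh ∈ Y)
    (N : Set (EucProd dx dy))
    (hN : N = {c | ∀ z' ∈ Z, ⟪c, z' - pmk xh yh⟫_ℝ ≤ 0})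
    (hsol : sInf ((fun c =>
        ‖pmk (gradient (fun x' => fε x' yh) xh) (-gradient (fun y' => fε xh y') yh) + c‖) '' N)
      ≤ ε / 2) :
    sInf ((fun c =>
        ‖pmk (gradient (fun x' => f x' yh) xh) (-gradient (fun y' => f xh y') yh) + c‖) '' N)
      ≤ ε := by
  have hgx : gradient (fun x' => fε x' yh) xh = gradient (fun x' => f x' yh) xh
      + (μx * ‖xh - x₀‖ ^ (p - 1)) • (xh - x₀) := by
    subst hfε
    refine HasGradientAt.gradient ?_
    rw [hasGradientAt_iff_hasFDerivAt, map_add]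
    exact ((hdx yh hyh xh hxh).hasGradientAt.hasFDerivAt.add
      (hasGradientAt_const_mul_norm_sub_pow p hp μx x₀ xh).hasFDerivAt).sub_const _
  have hgy : -gradient (fun y' => fε xh y') yh = -gradient (fun y' => f xh y') yh
      + (μy * ‖yh - y₀‖ ^ (p - 1)) • (yh - y₀) := by
    subst hfε
    rw [neg_eq_iff_eq_neg, neg_add, neg_neg, ← sub_eq_add_neg]
    refine HasGradientAt.gradient ?_
    rw [hasGradientAt_iff_hasFDerivAt, map_sub]
    exact ((hdy xh hxh yh hyh).hasGradientAt.hasFDerivAt.add_const _).sub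
      (hasGradientAt_const_mul_norm_sub_pow p hp μy y₀ yh).hasFDerivAt
  have hNne : N.Nonempty := ⟨0, by simp [hN]⟩
  rw [hgx, hgy, pmk_add] at hsol
  have hbx := norm_regularizer_gradient_le p hp hε hXcp.isBounded hDX hx₀ hxh
  have hby := norm_regularizer_gradient_le p hp hε hYcp.isBounded hDY hy₀ hyh
  rw [← hμx] at hbx
  rw [← hμy] at hby
  refine (sInf_norm_add_image_le hNne _ _).trans ((add_le_add hsol
    ((norm_pmk_le _ _).trans (add_le_add hbx hby))).trans_eq ?_)
  ring
end
end

section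
/- Let 𝒳 ⊆ ℝ^{d_x} be convex and 𝒴 ⊆ ℝ^{d_y} be convex and compact, let p ≥ 1 be an integer, μ_y > 0 and L^{xy} > 0. Let f : 𝒳 × 𝒴 → ℝ be differentiable in y, pth-order μ_y-uniformly concave in y for each fixed x ∈ 𝒳, and suppose ‖∇_y f(x₁,y) − ∇_y f(x₂,y)‖ ≤ L^{xy}‖x₁ − x₂‖ for all x₁, x₂ ∈ 𝒳 and all y ∈ 𝒴. Then for any x₁, x₂ ∈ 𝒳 and any maximizers y*(x₁) ∈ argmax_{y∈𝒴} f(x₁,y), y*(x₂) ∈ argmax_{y∈𝒴} f(x₂,y), one has (2μ_y/p)‖y*(x₁) − y*(x₂)‖^p ≤ L^{xy}‖x₁ − x₂‖ · ‖y*(x₁) − y*(x₂)‖; equivalently, (2μ_y/p)‖y*(x₁) − y*(x₂)‖^{p−1} ≤ L^{xy}‖x₁ − x₂‖ whenever y*(x₁) ≠ y*(x₂). -/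
open scoped InnerProductSpace

noncomputable section

/-- First-order necessary condition for a maximizer over a convex set. -/
theorem IsMaxOn.inner_gradient_sub_nonpos {E : Type*} [NormedAddCommGroup E]
    [InnerProductSpace ℝ E] [CompleteSpace E] {s : Set E} {g : E → ℝ} {a b : E}
    (hmax : IsMaxOn g s a) (hs : Convex ℝ s) (ha : a ∈ s) (hb : b ∈ s)
    (hg : DifferentiableAt ℝ g a) : ⟪gradient g a, b - a⟫_ℝ ≤ 0 := by
  simpa using hmax.localize.hasFDerivWithinAt_nonpos
    hg.hasGradientAt.hasFDerivAt.hasFDerivWithinAt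
    (sub_mem_posTangentConeAt_of_segment_subset (hs.segment_subset ha hb))

/-- Hölder-type continuity of the solution mapping
`y*(x) = argmax_{y∈𝒴} f(x,y)`.  `f` is differentiable in `y`, `p`th-order
`μ_y`-uniformly concave in `y` on `𝒴` for each fixed `x ∈ 𝒳`, and its
`y`-gradient is `L^{xy}`-Lipschitz in `x`.  Then for maximizers `y₁, y₂` of
`f(x₁,·)`, `f(x₂,·)` over `𝒴`, `(2μ_y/p)‖y₁ − y₂‖^p ≤ L^{xy}‖x₁ − x₂‖‖y₁ − y₂‖`;
equivalently `(2μ_y/p)‖y₁ − y₂‖^(p−1) ≤ L^{xy}‖x₁ − x₂‖` whenever `y₁ ≠ y₂`. -/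
theorem stmt7 (dx dy p : ℕ) (hp : 1 ≤ p) (μy Lxy : ℝ) (hμy : 0 < μy) (hLxy : 0 < Lxy)
    (X : Set (EuclideanSpace ℝ (Fin dx))) (hXconv : Convex ℝ X)
    (Y : Set (EuclideanSpace ℝ (Fin dy))) (hYconv : Convex ℝ Y) (hYcp : IsCompact Y)
    (f : EuclideanSpace ℝ (Fin dx) → EuclideanSpace ℝ (Fin dy) → ℝ)
    (hdy : ∀ x, Differentiable ℝ (fun y => f x y))
    (huy : ∀ x ∈ X, ∀ y ∈ Y, ∀ y' ∈ Y,
      f x y ≤ f x y' + ⟪gradient (fun s => f x s) y', y - y'⟫_ℝ - (μy / p) * ‖y - y'‖ ^ p)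
    (hcross : ∀ x₁ ∈ X, ∀ x₂ ∈ X, ∀ y,
      ‖gradient (fun s => f x₁ s) y - gradient (fun s => f x₂ s) y‖ ≤ Lxy * ‖x₁ - x₂‖)
    (x₁ : EuclideanSpace ℝ (Fin dx)) (hx₁ : x₁ ∈ X)
    (x₂ : EuclideanSpace ℝ (Fin dx)) (hx₂ : x₂ ∈ X)
    (y₁ : EuclideanSpace ℝ (Fin dy)) (hy₁ : y₁ ∈ Y) (hy₁max : IsMaxOn (fun y => f x₁ y) Y y₁)
    (y₂ : EuclideanSpace ℝ (Fin dy)) (hy₂ : y₂ ∈ Y) (hy₂max : IsMaxOn (fun y => f x₂ y) Y y₂) :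
    (2 * μy / p) * ‖y₁ - y₂‖ ^ p ≤ Lxy * ‖x₁ - x₂‖ * ‖y₁ - y₂‖ ∧
      (y₁ ≠ y₂ → (2 * μy / p) * ‖y₁ - y₂‖ ^ (p - 1) ≤ Lxy * ‖x₁ - x₂‖) := by
  have hmain : (2 * μy / p) * ‖y₁ - y₂‖ ^ p ≤ Lxy * ‖x₁ - x₂‖ * ‖y₁ - y₂‖ := by
    have hopt₁ := hy₁max.inner_gradient_sub_nonpos hYconv hy₁ hy₂ (hdy x₁ y₁)
    have hopt₂ := hy₂max.inner_gradient_sub_nonpos hYconv hy₂ hy₁ (hdy x₂ y₂)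
    have hconc₁₂ := huy x₁ hx₁ y₁ hy₁ y₂ hy₂
    have hconc₂₁ := huy x₁ hx₁ y₂ hy₂ y₁ hy₁
    rw [norm_sub_rev y₂ y₁] at hconc₂₁
    have hcs := real_inner_le_norm
      (gradient (fun s => f x₁ s) y₂ - gradient (fun s => f x₂ s) y₂) (y₁ - y₂)
    rw [inner_sub_left] at hcs
    have hlip := mul_le_mul_of_nonneg_right (hcross x₁ hx₁ x₂ hx₂ y₂) (norm_nonneg (y₁ - y₂))
    rw [mul_div_assoc, mul_assoc]
    linarith
  refine ⟨hmain, fun hne => ?_⟩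
  refine le_of_mul_le_mul_right ?_ (norm_pos_iff.mpr (sub_ne_zero.mpr hne))
  rwa [mul_assoc, pow_sub_one_mul (by omega)]
end
end

section
/- Let p ≥ 1 be an integer, L_p > 0, T ≥ 1 an integer, and let f̄, X̄, Ȳ be the hard instance f̄(x,y) = (L_p/(2^{p+1} p!)) ( y_1 (1 − x_1)^p + Σ_{i=1}^{T} y_{i+1} (x_i − x_{i+1})^p ), X̄ = {x ∈ ℝ^{T+1} : 1 ≥ x_1 ≥ … ≥ x_{T+1} ≥ 0}, Ȳ = [0,1]^{T+1}. Then for every (x,y) ∈ X̄ × Ȳ with x_{T+1} = 0 and y_{T+1} = 0, the duality gap satisfies Gap_{f̄}(x,y) = max_{y'∈Ȳ} f̄(x,y') − min_{x'∈X̄} f̄(x',y) ≥ L_p / (2^{p+1} p! (T+1)^{p−1}). -/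
noncomputable section

/-- The increments of a sequence from `1` to `0` in `T + 1` steps have a large sum of powers. -/
lemma one_div_pow_le_sum_increments_pow {p T : ℕ} (hp : 1 ≤ p) (x : Fin (T + 1) → ℝ)
    (hx0 : x 0 ≤ 1) (hanti : ∀ i : Fin T, x i.succ ≤ x i.castSucc) (hlast : x (Fin.last T) = 0) :
    1 / ((T : ℝ) + 1) ^ (p - 1) ≤
      (1 - x 0) ^ p + ∑ i : Fin T, (x i.castSucc - x i.succ) ^ p := by
  obtain ⟨q, rfl⟩ : ∃ q, p = q + 1 := ⟨p - 1, by omega⟩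
  let d : Fin (T + 1) → ℝ := Fin.cons (1 - x 0) fun i => x i.castSucc - x i.succ
  have hd : ∀ i ∈ (Finset.univ : Finset (Fin (T + 1))), 0 ≤ d i := by
    intro i _
    refine Fin.cases ?_ (fun j => ?_) i
    · simpa [d] using hx0
    · simpa [d] using hanti j
  have hsum : ∑ i, d i = 1 := by
    have h := (Fin.sum_univ_castSucc x).symm.trans (Fin.sum_univ_succ x)
    simp only [d, Fin.sum_univ_succ (Fin.cons _ _ : Fin (T + 1) → ℝ), Fin.cons_zero,
      Fin.cons_succ, Finset.sum_sub_distrib]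
    linarith
  have h := pow_sum_div_card_le_sum_pow hd q
  rw [hsum, Fin.sum_univ_succ] at h
  simpa [d] using h

/-- duality-gap lower bound for the hard instance.  For every
`(x, y) ∈ X̄ × Ȳ` whose last coordinates vanish (`x_{T+1} = y_{T+1} = 0`,
written `0`-indexed as `x (Fin.last T) = 0` etc.), the duality gap of `f̄` is at
least `L_p / (2^(p+1) p! (T+1)^(p−1))`. -/
theorem stmt10 (p T : ℕ) (hp : 1 ≤ p) (hT : 1 ≤ T) (Lp : ℝ) (hLp : 0 < Lp)
    (fbar : EuclideanSpace ℝ (Fin (T + 1)) → EuclideanSpace ℝ (Fin (T + 1)) → ℝ)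
    (hfbar : fbar = fun x y => Lp / (2 ^ (p + 1) * (p.factorial : ℝ)) *
      (y 0 * (1 - x 0) ^ p + ∑ i : Fin T, y i.succ * (x i.castSucc - x i.succ) ^ p))
    (Xbar : Set (EuclideanSpace ℝ (Fin (T + 1))))
    (hXbar : Xbar = {x | x 0 ≤ 1 ∧ (∀ i : Fin T, x i.succ ≤ x i.castSucc) ∧ 0 ≤ x (Fin.last T)})
    (Ybar : Set (EuclideanSpace ℝ (Fin (T + 1))))
    (hYbar : Ybar = {y | ∀ i, 0 ≤ y i ∧ y i ≤ 1})
    (x y : EuclideanSpace ℝ (Fin (T + 1))) (hx : x ∈ Xbar) (hy : y ∈ Ybar)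
    (hxlast : x (Fin.last T) = 0) (hylast : y (Fin.last T) = 0) :
    sSup ((fun y' => fbar x y') '' Ybar) - sInf ((fun x' => fbar x' y) '' Xbar)
      ≥ Lp / (2 ^ (p + 1) * (p.factorial : ℝ) * ((T : ℝ) + 1) ^ (p - 1)) := by
  have hc : 0 < Lp / (2 ^ (p + 1) * (p.factorial : ℝ)) := by positivity
  have hp0 : p ≠ 0 := by omega
  subst hfbar hXbar hYbar
  obtain ⟨hx0, hanti, -⟩ := hx
  have hsup : Lp / (2 ^ (p + 1) * (p.factorial : ℝ)) *
      ((1 - x 0) ^ p + ∑ i : Fin T, (x i.castSucc - x i.succ) ^ p) ≤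
      sSup ((fun y' : EuclideanSpace ℝ (Fin (T + 1)) => Lp / (2 ^ (p + 1) * (p.factorial : ℝ)) *
        (y' 0 * (1 - x 0) ^ p + ∑ i : Fin T, y' i.succ * (x i.castSucc - x i.succ) ^ p)) ''
        {y | ∀ i, 0 ≤ y i ∧ y i ≤ 1}) := by
    refine le_csSup ⟨Lp / (2 ^ (p + 1) * (p.factorial : ℝ)) *
      ((1 - x 0) ^ p + ∑ i : Fin T, (x i.castSucc - x i.succ) ^ p), ?_⟩
      ⟨WithLp.toLp 2 fun _ => 1, fun _ => by simp, by simp⟩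
    rintro _ ⟨y', hy', rfl⟩
    refine mul_le_mul_of_nonneg_left (add_le_add ?_ (Finset.sum_le_sum fun i _ => ?_)) hc.le
    · exact mul_le_of_le_one_left (pow_nonneg (sub_nonneg.2 hx0) p) (hy' 0).2
    · exact mul_le_of_le_one_left (pow_nonneg (sub_nonneg.2 (hanti i)) p) (hy' i.succ).2
  have hinf : sInf ((fun x' : EuclideanSpace ℝ (Fin (T + 1)) =>
      Lp / (2 ^ (p + 1) * (p.factorial : ℝ)) *
        (y 0 * (1 - x' 0) ^ p + ∑ i : Fin T, y i.succ * (x' i.castSucc - x' i.succ) ^ p)) ''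
        {x | x 0 ≤ 1 ∧ (∀ i : Fin T, x i.succ ≤ x i.castSucc) ∧ 0 ≤ x (Fin.last T)}) ≤ 0 := by
    refine csInf_le ⟨0, ?_⟩ ⟨WithLp.toLp 2 fun i => if i = Fin.last T then 0 else 1, ?_, ?_⟩
    · rintro _ ⟨x', ⟨hx0', hanti', -⟩, rfl⟩
      refine mul_nonneg hc.le (add_nonneg ?_ (Finset.sum_nonneg fun i _ => ?_))
      · exact mul_nonneg (hy 0).1 (pow_nonneg (sub_nonneg.2 hx0') p)
      · exact mul_nonneg (hy i.succ).1 (pow_nonneg (sub_nonneg.2 (hanti' i)) p)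
    · refine ⟨?_, fun i => ?_, by simp⟩
      · dsimp only
        split_ifs <;> norm_num
      · have h : i.castSucc ≠ Fin.last T := (Fin.castSucc_lt_last i).ne
        simp only [h, if_false]
        split_ifs <;> norm_num
    · have h0 : (0 : Fin (T + 1)) ≠ Fin.last T := by
        simp only [ne_eq, Fin.ext_iff, Fin.val_zero, Fin.val_last]
        omega
      have hsum : ∀ i : Fin T, y i.succ * ((if i.castSucc = Fin.last T then (0 : ℝ) else 1) -
          if i.succ = Fin.last T then 0 else 1) ^ p = 0 := by
        intro i
        have h : i.castSucc ≠ Fin.last T := (Fin.castSucc_lt_last i).ne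
        by_cases hi : i.succ = Fin.last T
        · rw [hi, hylast, zero_mul]
        · simp [h, hi, hp0]
      simp only [hsum, h0, if_false, sub_self, zero_pow hp0, mul_zero, Finset.sum_const_zero,
        add_zero]
  have hpow := mul_le_mul_of_nonneg_left
    (one_div_pow_le_sum_increments_pow hp x hx0 hanti hxlast) hc.le
  rw [div_mul_div_comm, mul_one] at hpow
  exact (hpow.trans hsup).trans (le_sub_self_iff _ |>.2 hinf)
end
end

section
/- Let p ≥ 1 be an integer, L_p > 0, T ≥ 1 an integer, and let f̄(x,y) = (L_p/(2^{p+1} p!)) ( y_1 (1 − x_1)^p + Σ_{i=1}^{T} y_{i+1} (x_i − x_{i+1})^p ) on ℝ^{T+1} × ℝ^{T+1}. Fix t with 1 ≤ t ≤ T and suppose x, y ∈ ℝ^{T+1} satisfy x_j = 0 for all j ≥ t+1 and y_j = 0 for all j ≥ t+1. Then the partial gradients satisfy (∇_x f̄(x,y))_j = 0 for all j ≥ t+1 and (∇_y f̄(x,y))_j = 0 for all j ≥ t+2. -/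
noncomputable section

/-- If `f` is constant on the line through `x` in the `j`-th coordinate direction, then the `j`-th
coordinate of its gradient at `x` vanishes. -/
theorem gradient_apply_eq_zero_of_const_line {ι : Type*} [Fintype ι] [DecidableEq ι]
    {f : EuclideanSpace ℝ ι → ℝ} {x : EuclideanSpace ℝ ι} {j : ι}
    (h : ∀ s : ℝ, f (x + s • EuclideanSpace.single j 1) = f x) : gradient f x j = 0 := by
  have hcoord : gradient f x j = fderiv ℝ f x (EuclideanSpace.single j 1) := by
    rw [← InnerProductSpace.toDual_symm_apply (𝕜 := ℝ), EuclideanSpace.inner_single_right]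
    simp [gradient]
  rw [hcoord]
  by_cases hf : DifferentiableAt ℝ f x
  · rw [← hf.lineDeriv_eq_fderiv]
    simp [lineDeriv, h]
  · simp [fderiv_zero_of_not_differentiableAt hf]

/-- support propagation (zero-chain property) of the partial
gradients of the hard instance.  Coordinates are written `0`-indexed:
the `1`-indexed condition "`x_j = 0` for all `j ≥ t+1`" becomes
"`x j = 0` for all `j : Fin (T+1)` with `t ≤ j`", and similarly for the
conclusions about `∇_x f̄` (coordinates `≥ t+1`, i.e. `0`-indexed `≥ t`) and
`∇_y f̄` (coordinates `≥ t+2`, i.e. `0`-indexed `≥ t+1`). -/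
theorem stmt12 (p T t : ℕ) (hp : 1 ≤ p) (ht : 1 ≤ t) (htT : t ≤ T)
    (Lp : ℝ) (hLp : 0 < Lp)
    (fbar : EuclideanSpace ℝ (Fin (T + 1)) → EuclideanSpace ℝ (Fin (T + 1)) → ℝ)
    (hfbar : fbar = fun x y => Lp / (2 ^ (p + 1) * (p.factorial : ℝ)) *
      (y 0 * (1 - x 0) ^ p + ∑ i : Fin T, y i.succ * (x i.castSucc - x i.succ) ^ p))
    (x y : EuclideanSpace ℝ (Fin (T + 1)))
    (hx : ∀ j : Fin (T + 1), t ≤ (j : ℕ) → x j = 0)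
    (hy : ∀ j : Fin (T + 1), t ≤ (j : ℕ) → y j = 0) :
    (∀ j : Fin (T + 1), t ≤ (j : ℕ) → gradient (fun x' => fbar x' y) x j = 0) ∧
      (∀ j : Fin (T + 1), t + 1 ≤ (j : ℕ) → gradient (fun y' => fbar x y') y j = 0) := by
  subst hfbar
  constructor
  · intro j hj
    refine gradient_apply_eq_zero_of_const_line fun s => ?_
    have h0 : (0 : Fin (T + 1)) ≠ j := by
      rintro rfl
      simp at hj
      omega
    dsimp only
    congr 2
    · simp [h0]
    · refine Finset.sum_congr rfl fun i _ => ?_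
      by_cases hi : t ≤ (i.succ : ℕ)
      · simp [hy _ hi]
      · have h1 : i.succ ≠ j := by
          rintro rfl
          exact hi hj
        have h2 : i.castSucc ≠ j := by
          rintro rfl
          simp at hi hj
          omega
        simp [h1, h2]
  · intro j hj
    refine gradient_apply_eq_zero_of_const_line fun s => ?_
    have h0 : (0 : Fin (T + 1)) ≠ j := by
      rintro rfl
      simp at hj
    dsimp only
    congr 2
    · simp [h0]
    · refine Finset.sum_congr rfl fun i _ => ?_
      by_cases hi : i.succ = j
      · subst hi
        have hti : t ≤ (i : ℕ) := by simpa using hj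
        rw [hx i.castSucc (by simpa using hti), hx i.succ (by simp; omega)]
        simp [show p ≠ 0 by omega]
      · simp [hi]
end
end

section
/- Let H be a real inner product space (e.g. ℝ^d), let Z ⊆ H be a nonempty closed convex set, and let v, z* ∈ Z. Let a ≥ 0, δ ≥ 0, and let g, w ∈ H satisfy ‖g − w‖ ≤ δ. Set v₊ = Proj_Z(v − a·g). Then (1/2)‖v₊ − z*‖² ≤ (1/2)‖v − z*‖² + a⟨w, z* − v⟩ + aδ‖v − z*‖ + a²‖w‖² + a²δ². -/
open scoped InnerProductSpace

noncomputable section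

/-- A distance-minimizing point `p` of a convex set `Z` is no farther from the points of `Z` than
the point being projected. -/
theorem norm_sub_sq_le_of_forall_norm_sub_le {H : Type*} [NormedAddCommGroup H]
    [InnerProductSpace ℝ H] {Z : Set H} (hZ : Convex ℝ Z) {u p z : H} (hp : p ∈ Z) (hz : z ∈ Z)
    (hmin : ∀ y ∈ Z, ‖p - u‖ ≤ ‖y - u‖) : ‖p - z‖ ^ 2 ≤ ‖u - z‖ ^ 2 := by
  have hinf : ‖u - p‖ = ⨅ y : Z, ‖u - y‖ := by
    have : Nonempty Z := ⟨⟨p, hp⟩⟩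
    apply le_antisymm
    · refine le_ciInf fun y => ?_
      rw [norm_sub_rev u p, norm_sub_rev u y]
      exact hmin y y.2
    · exact ciInf_le (f := fun y : Z => ‖u - y‖)
        ⟨0, by rintro _ ⟨y, rfl⟩; exact norm_nonneg _⟩ ⟨p, hp⟩
  have hinner := (norm_eq_iInf_iff_real_inner_le_zero hZ hp).1 hinf z hz
  have hexp := norm_sub_sq_real (u - p) (z - p)
  rw [sub_sub_sub_cancel_right, norm_sub_rev z p] at hexp
  nlinarith [sq_nonneg ‖u - p‖]

/-- one-step descent estimate for a projected step with an inexact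
direction.  `v₊` is the metric projection of `v − a • g` onto the nonempty closed
convex set `Z` (characterized as the point of `Z` minimizing the distance), and
`g` is a `δ`-approximation of `w`. -/
theorem stmt14 {H : Type*} [NormedAddCommGroup H] [InnerProductSpace ℝ H]
    (Z : Set H) (hZne : Z.Nonempty) (hZcl : IsClosed Z) (hZconv : Convex ℝ Z)
    (v zstar : H) (hv : v ∈ Z) (hzs : zstar ∈ Z)
    (a δ : ℝ) (ha : 0 ≤ a) (hδ : 0 ≤ δ)
    (g w : H) (hgw : ‖g - w‖ ≤ δ)
    (vplus : H) (hvZ : vplus ∈ Z)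
    (hvproj : ∀ u ∈ Z, ‖vplus - (v - a • g)‖ ≤ ‖u - (v - a • g)‖) :
    (1 / 2) * ‖vplus - zstar‖ ^ 2 ≤
      (1 / 2) * ‖v - zstar‖ ^ 2 + a * ⟪w, zstar - v⟫_ℝ + a * δ * ‖v - zstar‖
        + a ^ 2 * ‖w‖ ^ 2 + a ^ 2 * δ ^ 2 := by
  have hproj := norm_sub_sq_le_of_forall_norm_sub_le hZconv hvZ hzs hvproj
  have hexp : ‖v - a • g - zstar‖ ^ 2 =
      ‖v - zstar‖ ^ 2 + 2 * (a * ⟪g, zstar - v⟫_ℝ) + a ^ 2 * ‖g‖ ^ 2 := by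
    rw [sub_right_comm, norm_sub_sq_real, real_inner_smul_right, norm_smul, mul_pow,
      Real.norm_eq_abs, sq_abs, real_inner_comm, ← neg_sub zstar v, inner_neg_right, norm_neg]
    ring
  have hinner : ⟪g, zstar - v⟫_ℝ ≤ ⟪w, zstar - v⟫_ℝ + δ * ‖v - zstar‖ := by
    have h := real_inner_le_norm (g - w) (zstar - v)
    rw [inner_sub_left, norm_sub_rev zstar v] at h
    linarith [mul_le_mul_of_nonneg_right hgw (norm_nonneg (v - zstar))]
  have hg : ‖g‖ ^ 2 ≤ 2 * (‖w‖ ^ 2 + δ ^ 2) := by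
    have h : ‖g‖ ≤ ‖w‖ + δ := by linarith [norm_le_norm_add_norm_sub w g, norm_sub_rev w g]
    nlinarith [pow_le_pow_left₀ (norm_nonneg g) h 2, sq_nonneg (‖w‖ - δ)]
  have h₁ := mul_le_mul_of_nonneg_left hinner ha
  have h₂ := mul_le_mul_of_nonneg_left hg (sq_nonneg a)
  linarith
end
end

section
/- Let Z ⊆ ℝ^d be a nonempty convex set and let h : ℝ^d → ℝ be differentiable and convex on Z. Let z, v, z*, z̃ ∈ Z, let A ≥ 0 and a' > 0, set A' = A + a' and z̄ = (A/A')z + (a'/A')v. Let u ∈ N_Z(z̃), λ > 0, δ ≥ 0, and suppose the inexact proximal condition ‖∇h(z̃) + u + λ(z̃ − z̄)‖ ≤ (λ/2)‖z̃ − z̄‖ + δ holds. Then a'⟨∇h(z̃) + u, z* − v⟩ ≤ a'(h(z*) − h(z̃)) + A(h(z) − h(z̃)) − (A'/(2λ))‖∇h(z̃) + u‖² − (λ A'/4)‖z̃ − z̄‖² + (A'/λ)δ². -/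
open scoped InnerProductSpace

noncomputable section

/-- The first-order characterization of convexity on a set, at a point of differentiability. -/
theorem ConvexOn.inner_gradient_le_sub {E : Type*} [NormedAddCommGroup E]
    [InnerProductSpace ℝ E] [CompleteSpace E] {Z : Set E} {f : E → ℝ} (hf : ConvexOn ℝ Z f)
    {x y : E} (hx : x ∈ Z) (hy : y ∈ Z) (hd : DifferentiableAt ℝ f x) :
    ⟪gradient f x, y - x⟫_ℝ ≤ f y - f x := by
  have hg : ConvexOn ℝ (AffineMap.lineMap x y ⁻¹' Z) (f ∘ AffineMap.lineMap (k := ℝ) x y) :=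
    hf.comp_affineMap _
  have hderiv : HasDerivAt (f ∘ AffineMap.lineMap (k := ℝ) x y)
      ⟪gradient f x, y - x⟫_ℝ 0 := by
    have hcomp := hd.hasGradientAt.hasFDerivAt.comp_hasDerivAt_of_eq (0 : ℝ)
      (AffineMap.hasDerivAt_lineMap (a := x) (b := y)) (by simp)
    simpa using hcomp
  simpa [slope_def_field] using
    hg.le_slope_of_hasDerivAt (by simpa using hx) (by simpa using hy) zero_lt_one hderiv

/-- Rearrangement of the relative-error condition `‖w + λ e‖ ≤ (λ / 2) ‖e‖ + δ`. -/
theorem inner_le_of_norm_add_smul_le {E : Type*} [NormedAddCommGroup E]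
    [InnerProductSpace ℝ E] {w e : E} {lam δ : ℝ} (hlam : 0 < lam)
    (h : ‖w + lam • e‖ ≤ lam / 2 * ‖e‖ + δ) :
    ⟪w, e⟫_ℝ ≤ -(1 / (2 * lam)) * ‖w‖ ^ 2 - lam / 4 * ‖e‖ ^ 2 + 1 / lam * δ ^ 2 := by
  have hsq : ‖w + lam • e‖ ^ 2 ≤ (lam / 2 * ‖e‖ + δ) ^ 2 := by gcongr
  rw [norm_add_sq_real, inner_smul_right, norm_smul, Real.norm_of_nonneg hlam.le] at hsq
  have key : 2 * lam * ⟪w, e⟫_ℝ ≤ -‖w‖ ^ 2 - lam ^ 2 / 2 * ‖e‖ ^ 2 + 2 * δ ^ 2 := by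
    nlinarith [sq_nonneg (lam / 2 * ‖e‖ - δ)]
  refine le_of_mul_le_mul_left (key.trans_eq ?_) (by positivity : 0 < 2 * lam)
  field_simp
  ring

/-- the key per-iteration estimate for the accelerated inexact
proximal extragradient method.  `h` is differentiable (at points of `Z`) and
convex on the nonempty convex set `Z ⊆ ℝ^d`, `u` lies in the normal cone of `Z`
at `z̃`, and the inexact proximal condition holds. -/
theorem stmt15 (d : ℕ) (Z : Set (EuclideanSpace ℝ (Fin d)))
    (hZne : Z.Nonempty) (hZconv : Convex ℝ Z)
    (h : EuclideanSpace ℝ (Fin d) → ℝ)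
    (hdiff : ∀ z ∈ Z, DifferentiableAt ℝ h z)
    (hconv : ConvexOn ℝ Z h)
    (z v zstar ztil : EuclideanSpace ℝ (Fin d))
    (hz : z ∈ Z) (hv : v ∈ Z) (hzs : zstar ∈ Z) (hzt : ztil ∈ Z)
    (A a' : ℝ) (hA : 0 ≤ A) (ha' : 0 < a')
    (A' : ℝ) (hA' : A' = A + a')
    (zbar : EuclideanSpace ℝ (Fin d)) (hzbar : zbar = (A / A') • z + (a' / A') • v)
    (u : EuclideanSpace ℝ (Fin d)) (hu : ∀ z' ∈ Z, ⟪u, z' - ztil⟫_ℝ ≤ 0)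
    (lam δ : ℝ) (hlam : 0 < lam) (hδ : 0 ≤ δ)
    (hprox : ‖gradient h ztil + u + lam • (ztil - zbar)‖ ≤ (lam / 2) * ‖ztil - zbar‖ + δ) :
    a' * ⟪gradient h ztil + u, zstar - v⟫_ℝ ≤
      a' * (h zstar - h ztil) + A * (h z - h ztil)
        - (A' / (2 * lam)) * ‖gradient h ztil + u‖ ^ 2
        - (lam * A' / 4) * ‖ztil - zbar‖ ^ 2
        + (A' / lam) * δ ^ 2 := by
  have hA'pos : 0 < A' := by linarith
  have subgrad : ∀ y ∈ Z, ⟪gradient h ztil + u, y - ztil⟫_ℝ ≤ h y - h ztil := fun y hy => by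
    rw [inner_add_left]
    linarith [hconv.inner_gradient_le_sub hzt hy (hdiff ztil hzt), hu y hy]
  have hprox_inner := mul_le_mul_of_nonneg_left (inner_le_of_norm_add_smul_le hlam hprox) hA'pos.le
  have hvec : a' • (zstar - v) =
      a' • (zstar - ztil) + A • (z - ztil) + A' • (ztil - zbar) := by
    have hbar : A' • zbar = A • z + a' • v := by
      rw [hzbar, smul_add, smul_smul, smul_smul, mul_div_cancel₀ _ hA'pos.ne',
        mul_div_cancel₀ _ hA'pos.ne']
    rw [smul_sub A', hbar, hA']
    module
  have hsplit := congrArg (fun y => ⟪gradient h ztil + u, y⟫_ℝ) hvec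
  simp only [inner_add_right, inner_smul_right] at hsplit
  have hstar := mul_le_mul_of_nonneg_left (subgrad zstar hzs) ha'.le
  have hz_le := mul_le_mul_of_nonneg_left (subgrad z hz) hA
  rw [hsplit]
  refine (add_le_add (add_le_add hstar hz_le) hprox_inner).trans_eq ?_
  ring
end
end

section
/- Let Z ⊆ ℝ^d be a nonempty convex set, h : ℝ^d → ℝ differentiable and convex on Z, and let z* ∈ Z be a minimizer of h over Z. Let z̃, z̄ ∈ Z with z̃ ≠ z̄ and z̃ ≠ z*, let u ∈ N_Z(z̃), λ > 0, δ ≥ 0, and suppose ‖∇h(z̃) + u + λ(z̃ − z̄)‖ ≤ (λ/2)‖z̃ − z̄‖ + δ. Then (3λ/2)‖z̃ − z̄‖ ≥ ‖∇h(z̃) + u‖ − δ ≥ (h(z̃) − h(z*))/‖z̃ − z*‖ − δ. -/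
open scoped InnerProductSpace

noncomputable section

/-- First-order lower bound for a function that is convex on a set and differentiable at one of its
points. -/
theorem ConvexOn.add_inner_gradient_le {E : Type*} [NormedAddCommGroup E] [InnerProductSpace ℝ E]
    [CompleteSpace E] {s : Set E} {f : E → ℝ} (hf : ConvexOn ℝ s f) {x y : E} (hx : x ∈ s)
    (hy : y ∈ s) (hd : DifferentiableAt ℝ f x) :
    f x + ⟪gradient f x, y - x⟫_ℝ ≤ f y := by
  have hline : HasDerivAt (f ∘ AffineMap.lineMap (k := ℝ) x y) ⟪gradient f x, y - x⟫_ℝ 0 := by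
    have hg : HasFDerivAt f (InnerProductSpace.toDual ℝ E (gradient f x))
        (AffineMap.lineMap (k := ℝ) x y 0) := by
      simpa using hd.hasGradientAt.hasFDerivAt
    simpa using hg.comp_hasDerivAt (0 : ℝ) AffineMap.hasDerivAt_lineMap
  have hslope := (hf.comp_affineMap (AffineMap.lineMap (k := ℝ) x y)).le_slope_of_hasDerivAt
    (x := 0) (y := 1) (by simpa using hx) (by simpa using hy) one_pos hline
  simp only [slope_def_field, Function.comp_apply, AffineMap.lineMap_apply_one,
    AffineMap.lineMap_apply_zero, sub_zero, div_one] at hslope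
  linarith

/-- lower bound on the regularization weight `λ` from the inexact
proximal condition.  Here `h` is differentiable (at points of `Z`) and convex on
the nonempty convex set `Z ⊆ ℝ^d`, `z*` minimizes `h` over `Z`, and
`u` lies in the normal cone of `Z` at `z̃`. -/
theorem stmt18 (d : ℕ) (Z : Set (EuclideanSpace ℝ (Fin d)))
    (hZne : Z.Nonempty) (hZconv : Convex ℝ Z)
    (h : EuclideanSpace ℝ (Fin d) → ℝ)
    (hdiff : ∀ z ∈ Z, DifferentiableAt ℝ h z)
    (hconv : ConvexOn ℝ Z h)
    (zstar : EuclideanSpace ℝ (Fin d)) (hzsZ : zstar ∈ Z)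
    (hzsmin : ∀ z ∈ Z, h zstar ≤ h z)
    (ztil zbar : EuclideanSpace ℝ (Fin d)) (hztZ : ztil ∈ Z) (hzbZ : zbar ∈ Z)
    (hne1 : ztil ≠ zbar) (hne2 : ztil ≠ zstar)
    (u : EuclideanSpace ℝ (Fin d)) (hu : ∀ z' ∈ Z, ⟪u, z' - ztil⟫_ℝ ≤ 0)
    (lam δ : ℝ) (hlam : 0 < lam) (hδ : 0 ≤ δ)
    (hprox : ‖gradient h ztil + u + lam • (ztil - zbar)‖ ≤ (lam / 2) * ‖ztil - zbar‖ + δ) :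
    (3 * lam / 2) * ‖ztil - zbar‖ ≥ ‖gradient h ztil + u‖ - δ ∧
      ‖gradient h ztil + u‖ - δ ≥ (h ztil - h zstar) / ‖ztil - zstar‖ - δ := by
  constructor
  · have htri := norm_sub_le (gradient h ztil + u + lam • (ztil - zbar)) (lam • (ztil - zbar))
    rw [add_sub_cancel_right, norm_smul, Real.norm_of_nonneg hlam.le] at htri
    linarith
  · have hpos : 0 < ‖ztil - zstar‖ := norm_pos_iff.mpr (sub_ne_zero.mpr hne2)
    have hgrad := hconv.add_inner_gradient_le hztZ hzsZ (hdiff ztil hztZ)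
    have hnormal := hu zstar hzsZ
    have hcs := real_inner_le_norm (gradient h ztil + u) (ztil - zstar)
    rw [← neg_sub zstar ztil, inner_neg_right, inner_add_left, neg_sub] at hcs
    refine sub_le_sub_right ((div_le_iff₀ hpos).mpr ?_) δ
    linarith
end
end
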